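/- arXiv:1802.08297 — 3 statements merged into one kernel-verified Lean document; each statement's English description precedes it below -/
import Mathlib

section
/- Let d ≥ 2 be an even integer and let E ⊆ F_q^d. If |E| ≥ 9·q^{d/2}, then Δ(E)/Δ(E) = F_q, i.e., every element of F_q can be written as a/b with a ∈ Δ(E) and b ∈ Δ(E)\{0}. -/
open Finset

def nrm {F : Type} [Field F] {d : ℕ} (x : Fin d → F) : F := ∑ i, x i ^ 2

noncomputable def ft {F : Type} [Field F] [Fintype F] (d : ℕ) (χ : AddChar F ℂ)
    (f : (Fin d → F) → ℂ) (m : Fin d → F) : ℂ :=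
  (Fintype.card F : ℂ) ^ (-(d : ℤ)) * ∑ x : Fin d → F, χ (-(∑ i, x i * m i)) * f x

noncomputable def sphereFT {F : Type} [Field F] [Fintype F] [DecidableEq F] (d : ℕ)
    (χ : AddChar F ℂ) (t : F) (m : Fin d → F) : ℂ :=
  ft d χ (fun x => if nrm x = t then 1 else 0) m

noncomputable def eta (F : Type) [Field F] [Fintype F] [DecidableEq F] (s : F) : ℂ :=
  ((quadraticChar F s : ℤ) : ℂ)

noncomputable def gSum (F : Type) [Field F] [Fintype F] [DecidableEq F] (χ : AddChar F ℂ) : ℂ :=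
  ∑ s ∈ Finset.univ.filter (fun s : F => s ≠ 0), eta F s * χ s

def nu {F : Type} [Field F] [Fintype F] [DecidableEq F] {d : ℕ}
    (E : Finset (Fin d → F)) (t : F) : ℕ :=
  ((E ×ˢ E).filter (fun p => nrm (p.1 - p.2) = t)).card

def distSet {F : Type} [Field F] {d : ℕ} (E : Finset (Fin d → F)) : Set F :=
  {t | ∃ x ∈ E, ∃ y ∈ E, nrm (x - y) = t}

def quotSet {F : Type} [Field F] {d : ℕ} (E : Finset (Fin d → F)) : Set F :=
  {r | ∃ a ∈ distSet E, ∃ b ∈ distSet E, b ≠ 0 ∧ r = a / b}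

def sphereCard (F : Type) [Field F] [Fintype F] [DecidableEq F] (d : ℕ) (t : F) : ℕ :=
  (Finset.univ.filter (fun x : Fin d → F => nrm x = t)).card

section QuadraticSums

variable {F : Type} [Field F]

theorem four_ne_zero_of_ringChar_ne_two (hF : ringChar F ≠ 2) : (4 : F) ≠ 0 := by
  have h2 : (2 : F) ≠ 0 := Ring.two_ne_zero hF
  have : (4 : F) = 2 * 2 := by norm_num
  rw [this]
  exact mul_ne_zero h2 h2

theorem AddChar.IsPrimitive.mulShift_isPrimitive {χ : AddChar F ℂ} (hχ : χ.IsPrimitive)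
    {s : F} (hs : s ≠ 0) : (χ.mulShift s).IsPrimitive := by
  intro a ha
  rw [AddChar.mulShift_mulShift]
  exact hχ (mul_ne_zero hs ha)

theorem AddChar.map_sum_eq_prod' {ι : Type*} (χ : AddChar F ℂ) (t : Finset ι) (f : ι → F) :
    χ (∑ i ∈ t, f i) = ∏ i ∈ t, χ (f i) := by
  classical
  induction t using Finset.induction_on with
  | empty => simp
  | insert a t ha ih => rw [Finset.sum_insert ha, Finset.prod_insert ha, AddChar.map_add_eq_mul, ih]

/-- The exponential sum of the distances between points of `E`. -/
noncomputable def distExpSum {d : ℕ} (χ : AddChar F ℂ) (E : Finset (Fin d → F)) (s : F) : ℂ :=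
  ∑ p ∈ E ×ˢ E, χ (s * nrm (p.1 - p.2))

theorem distExpSum_zero {d : ℕ} (χ : AddChar F ℂ) (E : Finset (Fin d → F)) :
    distExpSum χ E 0 = (E.card : ℂ) ^ 2 := by
  simp [distExpSum, sq]

/-- The squared absolute value of the unnormalised Fourier transform of the indicator of `E`. -/
noncomputable def energyAt {d : ℕ} (χ : AddChar F ℂ) (E : Finset (Fin d → F))
    (m : Fin d → F) : ℝ :=
  Complex.normSq (∑ x ∈ E, χ (∑ i, m i * x i))

theorem energyAt_nonneg {d : ℕ} (χ : AddChar F ℂ) (E : Finset (Fin d → F)) (m : Fin d → F) :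
    0 ≤ energyAt χ E m := Complex.normSq_nonneg _

theorem energyAt_zero {d : ℕ} (χ : AddChar F ℂ) (E : Finset (Fin d → F)) :
    energyAt χ E 0 = (E.card : ℝ) ^ 2 := by
  simp [energyAt, sq]

variable [Fintype F]

/-- Completing the square in a one-variable quadratic exponential sum. -/
theorem sum_addChar_quadratic (hF : ringChar F ≠ 2) (χ : AddChar F ℂ) {s : F} (hs : s ≠ 0)
    (v : F) :
    ∑ x : F, χ (s * x ^ 2 + x * v) =
      χ (-(v ^ 2 / (4 * s))) * ∑ x : F, χ (s * x ^ 2) := by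
  have h2 : (2 : F) ≠ 0 := Ring.two_ne_zero hF
  have h4 : (4 : F) ≠ 0 := four_ne_zero_of_ringChar_ne_two hF
  rw [Finset.mul_sum, ← Equiv.sum_comp (Equiv.addRight (v / (2 * s))) (fun x => _ * χ (s * x ^ 2))]
  refine Finset.sum_congr rfl fun x _ => ?_
  rw [← AddChar.map_add_eq_mul, Equiv.coe_addRight]
  congr 1
  field_simp
  ring

theorem energyAt_eq_sum {d : ℕ} (χ : AddChar F ℂ) (E : Finset (Fin d → F)) (m : Fin d → F) :
    (energyAt χ E m : ℂ) = ∑ p ∈ E ×ˢ E, χ (∑ i, m i * (p.1 - p.2) i) := by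
  rw [energyAt, ← Complex.mul_conj, map_sum, Finset.sum_mul_sum, Finset.sum_product]
  refine Finset.sum_congr rfl fun x _ => Finset.sum_congr rfl fun y _ => ?_
  rw [← AddChar.map_neg_eq_conj, ← AddChar.map_add_eq_mul]
  congr 1
  simp [sub_eq_add_neg, Finset.sum_add_distrib, mul_add]

variable [DecidableEq F]

/-- The sum of `ψ` over the squares is the quadratic Gauss sum. -/
theorem sum_addChar_sq_eq_gaussSum (hF : ringChar F ≠ 2) {ψ : AddChar F ℂ}
    (hψ : ψ.IsPrimitive) :
    ∑ x : F, ψ (x ^ 2) =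
      gaussSum ((quadraticChar F).ringHomComp (Int.castRingHom ℂ)) ψ := by
  have hfib : ∑ x : F, ψ (x ^ 2) = ∑ a : F, ∑ x ∈ univ.filter (fun x : F => x ^ 2 = a), ψ a := by
    rw [← Finset.sum_fiberwise (s := univ) (g := fun x : F => x ^ 2)]
    refine Finset.sum_congr rfl fun a _ => Finset.sum_congr rfl fun x hx => ?_
    rw [(Finset.mem_filter.1 hx).2]
  have hcard (a : F) :
      ((univ.filter (fun x : F => x ^ 2 = a)).card : ℂ) = (quadraticChar F a : ℤ) + 1 := by
    have h := quadraticChar_card_sqrts hF a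
    have h2 : ((univ.filter (fun x : F => x ^ 2 = a)).card : ℤ) = quadraticChar F a + 1 := by
      rw [← h]
      congr 2
      ext x
      simp
    exact_mod_cast h2
  have hzero : ∑ a : F, ψ a = 0 := by
    simpa using AddChar.sum_mulShift (1 : F) hψ
  rw [hfib]
  simp only [Finset.sum_const, nsmul_eq_mul, hcard, add_mul, one_mul, Finset.sum_add_distrib,
    hzero, add_zero, gaussSum]
  rfl

theorem sum_addChar_sq_sq (hF : ringChar F ≠ 2) {χ : AddChar F ℂ} (hχ : χ.IsPrimitive)
    {s : F} (hs : s ≠ 0) :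
    (∑ x : F, χ (s * x ^ 2)) ^ 2 = ((quadraticChar F (-1) : ℤ) : ℂ) * Fintype.card F := by
  have h := sum_addChar_sq_eq_gaussSum hF (hχ.mulShift_isPrimitive hs)
  simp only [AddChar.mulShift_apply] at h
  rw [h, gaussSum_sq _ ((quadraticChar_isQuadratic F).comp _) (hχ.mulShift_isPrimitive hs)]
  · rfl
  · exact (MulChar.ringHomComp_ne_one_iff Int.cast_injective).2 (quadraticChar_ne_one hF)

/-- The exponential sum of a nondegenerate multiple of `nrm` in an even number of variables. -/
theorem sum_addChar_nrm (hF : ringChar F ≠ 2) {χ : AddChar F ℂ} (hχ : χ.IsPrimitive)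
    {s : F} (hs : s ≠ 0) (k : ℕ) (v : Fin (k + k) → F) :
    ∑ m : Fin (k + k) → F, χ (s * nrm m + ∑ i, m i * v i) =
      (((quadraticChar F (-1) : ℤ) : ℂ) ^ k * (Fintype.card F : ℂ) ^ k) *
        χ (-(nrm v / (4 * s))) := by
  have hprod : ∑ m : Fin (k + k) → F, χ (s * nrm m + ∑ i, m i * v i) =
      ∏ i, ∑ x : F, χ (s * x ^ 2 + x * v i) := by
    rw [Finset.prod_univ_sum, Fintype.piFinset_univ]
    refine Finset.sum_congr rfl fun m _ => ?_
    rw [nrm, Finset.mul_sum, ← Finset.sum_add_distrib, AddChar.map_sum_eq_prod']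
  rw [hprod]
  simp only [sum_addChar_quadratic hF χ hs]
  have hconst (c : ℂ) : ∏ _i : Fin (k + k), c = (c ^ 2) ^ k := by
    rw [Fin.prod_const, ← two_mul, pow_mul]
  rw [Finset.prod_mul_distrib, ← AddChar.map_sum_eq_prod', hconst, sum_addChar_sq_sq hF hχ hs,
    mul_pow, mul_comm, Finset.sum_neg_distrib, nrm, Finset.sum_div]

theorem sum_sum_weighted_addChar {χ : AddChar F ℂ} (hχ : χ.IsPrimitive) {ι : Type*}
    (I : Finset ι) (w : ι → ℂ) (f : ι → F) :
    ∑ s : F, ∑ i ∈ I, w i * χ (s * f i) =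
      Fintype.card F * ∑ i ∈ I.filter (fun i => f i = 0), w i := by
  rw [Finset.sum_comm, Finset.sum_filter, Finset.mul_sum]
  refine Finset.sum_congr rfl fun i _ => ?_
  rw [← Finset.mul_sum, AddChar.sum_mulShift _ hχ]
  split_ifs <;> simp [mul_comm]

theorem sum_ne_zero_sum_weighted_addChar {χ : AddChar F ℂ} (hχ : χ.IsPrimitive) {ι : Type*}
    (I : Finset ι) (w : ι → ℂ) (f : ι → F) :
    ∑ s ∈ univ.erase (0 : F), ∑ i ∈ I, w i * χ (s⁻¹ * f i) =
      Fintype.card F * ∑ i ∈ I.filter (fun i => f i = 0), w i - ∑ i ∈ I, w i := by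
  rw [← sum_sum_weighted_addChar hχ, ← Equiv.sum_comp (Equiv.inv F),
    ← Finset.add_sum_erase univ _ (Finset.mem_univ (0 : F))]
  simp

theorem sum_energyAt {d : ℕ} {χ : AddChar F ℂ} (hχ : χ.IsPrimitive) (E : Finset (Fin d → F)) :
    ∑ m, energyAt χ E m = (Fintype.card F : ℝ) ^ d * E.card := by
  have horth (v : Fin d → F) : ∑ m : Fin d → F, χ (∑ i, m i * v i) =
      if v = 0 then (Fintype.card F : ℂ) ^ d else 0 := by
    have hprod : ∑ m : Fin d → F, χ (∑ i, m i * v i) = ∏ i, ∑ x : F, χ (x * v i) := by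
      rw [Finset.prod_univ_sum, Fintype.piFinset_univ]
      exact Finset.sum_congr rfl fun m _ => AddChar.map_sum_eq_prod' _ _ _
    rw [hprod]
    simp only [AddChar.sum_mulShift _ hχ]
    split_ifs with h
    · simp [h]
    · obtain ⟨i, hi⟩ := Function.ne_iff.1 h
      exact Finset.prod_eq_zero (Finset.mem_univ i) (by simpa using hi)
  have h : ((∑ m, energyAt χ E m : ℝ) : ℂ) = (Fintype.card F : ℂ) ^ d * E.card := by
    push_cast
    simp only [energyAt_eq_sum]
    rw [Finset.sum_comm]
    simp only [horth, sub_eq_zero]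
    rw [Finset.sum_product]
    simp [mul_comm]
  exact_mod_cast h

theorem quadraticChar_neg_one_pow_sq (k : ℕ) :
    (((quadraticChar F (-1) : ℤ) : ℂ) ^ k) ^ 2 = 1 := by
  rw [← pow_mul, mul_comm, pow_mul]
  have h := quadraticChar_sq_one (F := F) (a := -1) (by simp)
  have h' : ((quadraticChar F (-1) : ℤ) : ℂ) ^ 2 = 1 := by exact_mod_cast h
  rw [h', one_pow]

theorem distExpSum_eq (hF : ringChar F ≠ 2) {χ : AddChar F ℂ} (hχ : χ.IsPrimitive)
    {k : ℕ} (E : Finset (Fin (k + k) → F)) {s : F} (hs : s ≠ 0) :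
    (Fintype.card F : ℂ) ^ k * distExpSum χ E s =
      ((quadraticChar F (-1) : ℤ) : ℂ) ^ k *
        ∑ m, (energyAt χ E m : ℂ) * χ (s⁻¹ * (-nrm m / 4)) := by
  have h4 : (4 : F) ≠ 0 := four_ne_zero_of_ringChar_ne_two hF
  have hs' : -(4 * s)⁻¹ ≠ 0 := neg_ne_zero.2 (inv_ne_zero (mul_ne_zero h4 hs))
  have hsum : ∑ m, (energyAt χ E m : ℂ) * χ (s⁻¹ * (-nrm m / 4)) =
      (((quadraticChar F (-1) : ℤ) : ℂ) ^ k * (Fintype.card F : ℂ) ^ k) * distExpSum χ E s := by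
    simp only [energyAt_eq_sum, Finset.sum_mul, distExpSum, Finset.mul_sum]
    rw [Finset.sum_comm]
    refine Finset.sum_congr rfl fun p _ => ?_
    have h := sum_addChar_nrm hF hχ hs' k (p.1 - p.2)
    have harg : -(nrm (p.1 - p.2) / (4 * -(4 * s)⁻¹)) = s * nrm (p.1 - p.2) := by
      field_simp
    rw [harg] at h
    rw [← h]
    refine Finset.sum_congr rfl fun m _ => ?_
    rw [← AddChar.map_add_eq_mul]
    congr 1
    field_simp
    ring
  rw [hsum]
  linear_combination (-(Fintype.card F : ℂ) ^ k * distExpSum χ E s) *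
    quadraticChar_neg_one_pow_sq (F := F) k

/-- The number of pairs of points of `E` at distance zero. -/
theorem card_nu_zero (hF : ringChar F ≠ 2) {χ : AddChar F ℂ} (hχ : χ.IsPrimitive)
    {k : ℕ} (E : Finset (Fin (k + k) → F)) :
    (Fintype.card F : ℝ) ^ k * Fintype.card F * nu E 0 =
      (Fintype.card F : ℝ) ^ k * E.card ^ 2 + ((quadraticChar F (-1) : ℤ) : ℝ) ^ k *
        (Fintype.card F * ∑ m with nrm m = 0, energyAt χ E m - ∑ m, energyAt χ E m) := by
  have h4 : (4 : F) ≠ 0 := four_ne_zero_of_ringChar_ne_two hF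
  have hleft := sum_sum_weighted_addChar hχ (E ×ˢ E) (fun _ => 1) (fun p => nrm (p.1 - p.2))
  simp only [one_mul, Finset.sum_const, nsmul_eq_mul, mul_one] at hleft
  have hright := sum_ne_zero_sum_weighted_addChar hχ univ
    (fun m : Fin (k + k) → F => (energyAt χ E m : ℂ)) (fun m => -nrm m / 4)
  simp only [div_eq_zero_iff, h4, or_false, neg_eq_zero] at hright
  have h : (Fintype.card F : ℂ) ^ k * Fintype.card F * nu E 0 =
      (Fintype.card F : ℂ) ^ k * E.card ^ 2 + ((quadraticChar F (-1) : ℤ) : ℂ) ^ k *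
        (Fintype.card F * ∑ m with nrm m = 0, (energyAt χ E m : ℂ) -
          ∑ m, (energyAt χ E m : ℂ)) := by
    rw [← hright, mul_assoc, nu, ← hleft, ← Finset.add_sum_erase univ _ (Finset.mem_univ (0 : F)),
      mul_add, Finset.mul_sum (univ.erase 0), Finset.mul_sum (univ.erase 0)]
    congr 1
    · rw [← distExpSum_zero χ E]
      rfl
    · exact Finset.sum_congr rfl fun s hs => distExpSum_eq hF hχ E (Finset.ne_of_mem_erase hs)
  exact_mod_cast h

/-- The number of pairs of pairs of points of `E` whose distances have ratio `r`. -/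
theorem card_distance_ratio (hF : ringChar F ≠ 2) {χ : AddChar F ℂ} (hχ : χ.IsPrimitive)
    {k : ℕ} (E : Finset (Fin (k + k) → F)) {r : F} (hr : r ≠ 0) :
    ((Fintype.card F : ℝ) ^ k) ^ 2 * Fintype.card F *
        (((E ×ˢ E) ×ˢ (E ×ˢ E)).filter
          (fun p => r * nrm (p.1.1 - p.1.2) - nrm (p.2.1 - p.2.2) = 0)).card =
      ((Fintype.card F : ℝ) ^ k) ^ 2 * E.card ^ 4 +
        (Fintype.card F * ∑ p : (Fin (k + k) → F) × (Fin (k + k) → F) with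
            r⁻¹ * nrm p.1 - nrm p.2 = 0, energyAt χ E p.1 * energyAt χ E p.2 -
          (∑ m, energyAt χ E m) ^ 2) := by
  have h4 : (4 : F) ≠ 0 := four_ne_zero_of_ringChar_ne_two hF
  have hleft := sum_sum_weighted_addChar hχ ((E ×ˢ E) ×ˢ (E ×ˢ E)) (fun _ => 1)
    (fun p => r * nrm (p.1.1 - p.1.2) - nrm (p.2.1 - p.2.2))
  simp only [one_mul, Finset.sum_const, nsmul_eq_mul, mul_one] at hleft
  have hright := sum_ne_zero_sum_weighted_addChar hχ univ
    (fun p : (Fin (k + k) → F) × (Fin (k + k) → F) => (energyAt χ E p.1 * energyAt χ E p.2 : ℂ))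
    (fun p => -(r⁻¹ * nrm p.1 - nrm p.2) / 4)
  simp only [div_eq_zero_iff, h4, or_false, neg_eq_zero] at hright
  have hfactor (s : F) : ∑ p ∈ (E ×ˢ E) ×ˢ (E ×ˢ E),
      χ (s * (r * nrm (p.1.1 - p.1.2) - nrm (p.2.1 - p.2.2))) =
        distExpSum χ E (s * r) * distExpSum χ E (-s) := by
    rw [distExpSum, distExpSum, Finset.sum_mul_sum, Finset.sum_product]
    refine Finset.sum_congr rfl fun p _ => Finset.sum_congr rfl fun p' _ => ?_
    rw [← AddChar.map_add_eq_mul]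
    congr 1
    ring
  have hsq : (∑ m, (energyAt χ E m : ℂ)) ^ 2 =
      ∑ p : (Fin (k + k) → F) × (Fin (k + k) → F),
        (energyAt χ E p.1 * energyAt χ E p.2 : ℂ) := by
    rw [sq, Finset.sum_mul_sum, Fintype.sum_prod_type]
  have h : ((Fintype.card F : ℂ) ^ k) ^ 2 * Fintype.card F *
        (((E ×ˢ E) ×ˢ (E ×ˢ E)).filter
          (fun p => r * nrm (p.1.1 - p.1.2) - nrm (p.2.1 - p.2.2) = 0)).card =
      ((Fintype.card F : ℂ) ^ k) ^ 2 * E.card ^ 4 +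
        (Fintype.card F * ∑ p : (Fin (k + k) → F) × (Fin (k + k) → F) with
            r⁻¹ * nrm p.1 - nrm p.2 = 0, (energyAt χ E p.1 * energyAt χ E p.2 : ℂ) -
          (∑ m, (energyAt χ E m : ℂ)) ^ 2) := by
    rw [hsq, ← hright, mul_assoc, ← hleft,
      ← Finset.add_sum_erase univ _ (Finset.mem_univ (0 : F)), mul_add, Finset.mul_sum (univ.erase 0)]
    congr 1
    · rw [hfactor, zero_mul, neg_zero, distExpSum_zero]
      ring
    · refine Finset.sum_congr rfl fun s hs => ?_
      have hs0 := Finset.ne_of_mem_erase hs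
      rw [hfactor]
      have e1 := distExpSum_eq hF hχ E (mul_ne_zero hs0 hr)
      have e2 := distExpSum_eq hF hχ E (neg_ne_zero.2 hs0)
      calc ((Fintype.card F : ℂ) ^ k) ^ 2 * (distExpSum χ E (s * r) * distExpSum χ E (-s))
          = ((Fintype.card F : ℂ) ^ k * distExpSum χ E (s * r)) *
              ((Fintype.card F : ℂ) ^ k * distExpSum χ E (-s)) := by ring
        _ = ((((quadraticChar F (-1) : ℤ) : ℂ) ^ k) ^ 2) *
              ((∑ m, (energyAt χ E m : ℂ) * χ ((s * r)⁻¹ * (-nrm m / 4))) *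
                ∑ m, (energyAt χ E m : ℂ) * χ ((-s)⁻¹ * (-nrm m / 4))) := by
            rw [e1, e2]
            ring
        _ = _ := by
            rw [quadraticChar_neg_one_pow_sq, one_mul, Finset.sum_mul_sum, Fintype.sum_prod_type]
            refine Finset.sum_congr rfl fun m _ => Finset.sum_congr rfl fun m' _ => ?_
            rw [mul_mul_mul_comm, ← AddChar.map_add_eq_mul]
            congr 2
            field_simp
            ring
  exact_mod_cast h

theorem card_ratio_gt_of_estimates {n q Q A P N z ε : ℝ} (hε : ε = 1 ∨ ε = -1) (hq : 3 ≤ q)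
    (hQ : 0 < Q) (hn : 2 * Q < n) (hA₁ : n ^ 2 ≤ A) (hA₂ : A ≤ Q ^ 2 * n) (hP : A ^ 2 ≤ P)
    (hz : Q * q * z = Q * n ^ 2 + ε * (q * A - Q ^ 2 * n))
    (hN : Q ^ 2 * q * N = Q ^ 2 * n ^ 4 + (q * P - (Q ^ 2 * n) ^ 2)) : z ^ 2 < N := by
  have hq0 : 0 < q := by linarith
  have hn0 : 0 < n := by linarith
  have hmul : (Q * q) ^ 2 * z ^ 2 < (Q * q) ^ 2 * N := by
    have e1 : (Q * q) ^ 2 * z ^ 2 = (Q * n ^ 2 + ε * (q * A - Q ^ 2 * n)) ^ 2 := by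
      rw [← hz]
      ring
    have e2 : (Q * q) ^ 2 * N = q * (Q ^ 2 * n ^ 4 + (q * P - (Q ^ 2 * n) ^ 2)) := by
      rw [← hN]
      ring
    rw [e1, e2]
    have hqP : q ^ 2 * A ^ 2 ≤ q ^ 2 * P := by gcongr
    rcases hε with rfl | rfl
    · have h1 : 0 < Q ^ 2 * n ^ 2 * (n - Q) ^ 2 * (q - 1) := by
        have : 0 < n - Q := by linarith
        have : 0 < q - 1 := by linarith
        positivity
      have h2 : 0 ≤ 2 * q * Q * n * (n - Q) * (Q ^ 2 * n - A) :=
        mul_nonneg (mul_nonneg (by positivity) (by linarith)) (by linarith)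
      linarith
    · have h1 : 0 < Q ^ 2 * n ^ 2 * (n + Q) * (q * (n - Q) - (n + Q)) := by
        have : 0 < q * (n - Q) - (n + Q) := by nlinarith
        positivity
      have h2 : 0 ≤ 2 * q * A * Q * (n ^ 2 + Q * n) := by
        have : 0 ≤ A := (sq_nonneg n).trans hA₁
        positivity
      linarith
  exact lt_of_mul_lt_mul_left hmul (by positivity)

theorem exists_distances_with_ratio (hF : ringChar F ≠ 2) (hq : 3 ≤ Fintype.card F) {k : ℕ}
    (E : Finset (Fin (k + k) → F)) (hE : 2 * (Fintype.card F : ℝ) ^ k < E.card)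
    {r : F} (hr : r ≠ 0) :
    ∃ a ∈ distSet E, ∃ b ∈ distSet E, b ≠ 0 ∧ r * b = a := by
  set χ := AddChar.FiniteField.primitiveChar_to_Complex F
  have hχ : χ.IsPrimitive := AddChar.FiniteField.primitiveChar_to_Complex_isPrimitive F
  have hsum : ∑ m, energyAt χ E m = ((Fintype.card F : ℝ) ^ k) ^ 2 * E.card := by
    rw [sum_energyAt hχ, pow_add, sq]
  have hz := card_nu_zero hF hχ E
  have hN := card_distance_ratio hF hχ E hr
  rw [hsum] at hz hN
  have hε : ((quadraticChar F (-1) : ℤ) : ℝ) ^ k = 1 ∨ ((quadraticChar F (-1) : ℤ) : ℝ) ^ k = -1 := by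
    rcases quadraticChar_dichotomy (F := F) (a := -1) (by simp) with h | h
    · simp [h]
    · simpa [h] using neg_one_pow_eq_or ℝ k
  have hQ : (0 : ℝ) < (Fintype.card F : ℝ) ^ k := pow_pos (by exact_mod_cast Fintype.card_pos) k
  have hlt := card_ratio_gt_of_estimates hε (by exact_mod_cast hq) hQ hE ?_ ?_ ?_ hz hN
  rotate_left
  · rw [← energyAt_zero χ E]
    exact Finset.single_le_sum (f := energyAt χ E) (fun m _ => energyAt_nonneg χ E m)
      (Finset.mem_filter.2 ⟨Finset.mem_univ _, by simp [nrm]⟩)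
  · rw [← hsum]
    exact Finset.sum_le_sum_of_subset_of_nonneg (Finset.filter_subset _ _)
      fun m _ _ => energyAt_nonneg χ E m
  · rw [sq, Finset.sum_mul_sum, ← Finset.sum_product']
    refine Finset.sum_le_sum_of_subset_of_nonneg ?_
      fun p _ _ => mul_nonneg (energyAt_nonneg χ E p.1) (energyAt_nonneg χ E p.2)
    intro p hp
    simp only [Finset.mem_product, Finset.mem_filter, Finset.mem_univ, true_and] at hp ⊢
    simp [hp.1, hp.2]
  norm_cast at hlt
  rw [nu, sq, ← Finset.card_product] at hlt
  obtain ⟨p, hp, hp'⟩ := Finset.exists_mem_notMem_of_card_lt_card hlt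
  simp only [Finset.mem_product, Finset.mem_filter] at hp hp'
  obtain ⟨⟨⟨hx, hy⟩, hz, hw⟩, hpr⟩ := hp
  refine ⟨_, ⟨_, hz, _, hw, rfl⟩, _, ⟨_, hx, _, hy, rfl⟩, ?_, sub_eq_zero.1 hpr⟩
  intro h0
  rw [h0, mul_zero, zero_sub, neg_eq_zero] at hpr
  exact hp' ⟨⟨⟨hx, hy⟩, h0⟩, ⟨hz, hw⟩, hpr⟩

end QuadraticSums

theorem quot_dist_even (F : Type) [Field F] [Fintype F] [DecidableEq F]
    (hq : Odd (Fintype.card F)) (d : ℕ) (hd : 2 ≤ d) (hde : Even d)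
    (E : Finset (Fin d → F))
    (hE : (9 : ℝ) * (Fintype.card F : ℝ) ^ ((d : ℝ) / 2) ≤ (E.card : ℝ)) :
    quotSet E = Set.univ := by
  obtain ⟨k, rfl⟩ := hde
  have hF : ringChar F ≠ 2 := fun h => by
    have := FiniteField.even_card_of_char_two h
    rw [Nat.odd_iff] at hq
    omega
  have hq3 : 3 ≤ Fintype.card F := by
    have := Fintype.one_lt_card (α := F)
    rw [Nat.odd_iff] at hq
    omega
  have hE' : 2 * (Fintype.card F : ℝ) ^ k < E.card := by
    have hk : ((k + k : ℕ) : ℝ) / 2 = k := by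
      push_cast
      ring
    rw [hk, Real.rpow_natCast] at hE
    have : (0 : ℝ) < (Fintype.card F : ℝ) ^ k := pow_pos (by exact_mod_cast Fintype.card_pos) k
    linarith
  refine Set.eq_univ_of_forall fun r => ?_
  by_cases hr : r = 0
  · obtain ⟨_, -, b, hb, hb0, -⟩ := exists_distances_with_ratio hF hq3 E hE' one_ne_zero
    have ⟨x, hx, _⟩ := hb
    exact ⟨0, ⟨x, hx, x, hx, by simp [nrm]⟩, b, hb, hb0, by simp [hr]⟩
  · obtain ⟨a, ha, b, hb, hb0, hab⟩ := exists_distances_with_ratio hF hq3 E hE' hr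
    exact ⟨a, ha, b, hb, hb0, eq_div_of_mul_eq hb0 hab⟩
end

section
/- Let d ≥ 3 be odd, E ⊆ F_q^d, and let r ∈ F_q^* be a nonzero square. Then Σ_{t ∈ F_q} ν(t)·ν(rt) ≥ q^{−1}·|E|⁴ − 2·|E|³ − q^{d−1}·|E|². -/
open Finset

theorem two_ne_zero_of_odd_card (F : Type*) [Field F] [Fintype F] (hq : Odd (Fintype.card F)) :
    (2 : F) ≠ 0 :=
  Ring.two_ne_zero fun h =>
    (Nat.not_even_iff_odd.mpr hq) (Nat.even_iff.mpr (FiniteField.even_card_of_char_two h))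

theorem addChar_map_sum {A M ι : Type*} [AddCommMonoid A] [CommMonoid M] (χ : AddChar A M)
    (s : Finset ι) (f : ι → A) : χ (∑ i ∈ s, f i) = ∏ i ∈ s, χ (f i) :=
  map_prod χ.toMonoidHom (fun i => Multiplicative.ofAdd (f i)) s

theorem nrm_add {F : Type} [Field F] {d : ℕ} (x y : Fin d → F) :
    nrm (x + y) = nrm x + 2 * (∑ i, x i * y i) + nrm y := by
  simp only [nrm, Finset.mul_sum, ← Finset.sum_add_distrib, Pi.add_apply]
  exact Finset.sum_congr rfl fun i _ => by ring

theorem nrm_smul {F : Type} [Field F] {d : ℕ} (a : F) (x : Fin d → F) :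
    nrm (a • x) = a ^ 2 * nrm x := by
  simp [nrm, Finset.mul_sum, mul_pow]

section CharacterSums

variable {F : Type} [Field F] [Fintype F] {χ : AddChar F ℂ} {d : ℕ}

/-- The squared modulus of the (unnormalised) Fourier transform of the indicator of `E`. -/
noncomputable def energyFT (χ : AddChar F ℂ) (E : Finset (Fin d → F)) (m : Fin d → F) : ℝ :=
  Complex.normSq (∑ x ∈ E, χ (∑ i, m i * x i))

theorem energyFT_eq (E : Finset (Fin d → F)) (m : Fin d → F) :
    (energyFT χ E m : ℂ) = ∑ x ∈ E, ∑ y ∈ E, χ (∑ i, m i * (x - y) i) := by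
  rw [energyFT, ← Complex.mul_conj, map_sum, Finset.sum_mul_sum]
  refine Finset.sum_congr rfl fun x _ => Finset.sum_congr rfl fun y _ => ?_
  rw [← AddChar.map_neg_eq_conj, ← AddChar.map_add_eq_mul]
  simp [mul_sub, ← sub_eq_add_neg]

/-- The quadratic Gauss sum of the form `u • nrm` in `d` variables. -/
noncomputable def quadGaussSum (d : ℕ) (χ : AddChar F ℂ) (u : F) : ℂ :=
  ∑ m : Fin d → F, χ (u * nrm m)

theorem quadGaussSum_sq_mul {a : F} (ha : a ≠ 0) (u : F) :
    quadGaussSum d χ (a ^ 2 * u) = quadGaussSum d χ u := by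
  unfold quadGaussSum
  rw [← Equiv.sum_comp (MulAction.toPerm (Units.mk0 a ha)) fun m : Fin d → F => χ (u * nrm m)]
  refine Finset.sum_congr rfl fun m _ => ?_
  have h : (MulAction.toPerm (Units.mk0 a ha)) m = a • m := rfl
  rw [h, nrm_smul]
  ring_nf

theorem addChar_mul_quadGaussSum (h2 : (2 : F) ≠ 0) {s : F} (hs : s ≠ 0) (v : Fin d → F) :
    χ (s * nrm v) * quadGaussSum d χ (-(4 * s)⁻¹) =
      ∑ m : Fin d → F, χ (-(4 * s)⁻¹ * nrm m) * χ (∑ i, m i * v i) := by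
  unfold quadGaussSum
  have h4 : (4 : F) ≠ 0 := by
    rw [show (4 : F) = 2 * 2 by norm_num]; exact mul_ne_zero h2 h2
  rw [← Equiv.sum_comp (Equiv.addRight ((-(2 * s)) • v)), Finset.mul_sum]
  refine Finset.sum_congr rfl fun m _ => ?_
  rw [← AddChar.map_add_eq_mul, ← AddChar.map_add_eq_mul, Equiv.coe_addRight, nrm_add, nrm_smul]
  have e1 : ∑ i, m i * ((-(2 * s)) • v) i = -(2 * s) * ∑ i, m i * v i := by
    rw [Finset.mul_sum]
    exact Finset.sum_congr rfl fun i _ => by simp only [Pi.smul_apply, smul_eq_mul]; ring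
  rw [e1]
  congr 1
  field_simp
  ring

variable [DecidableEq F]

theorem sum_addChar_dotProduct (hχ : χ.IsPrimitive) (h : Fin d → F) :
    ∑ m : Fin d → F, χ (∑ i, m i * h i) = if h = 0 then (Fintype.card F : ℂ) ^ d else 0 := by
  have key : ∑ m : Fin d → F, χ (∑ i, m i * h i) = ∏ i, ∑ a : F, χ (a * h i) := by
    rw [Finset.prod_univ_sum, Fintype.piFinset_univ]
    exact Finset.sum_congr rfl fun m _ => addChar_map_sum χ _ _
  rw [key]
  simp_rw [AddChar.sum_mulShift _ hχ]
  split_ifs with h0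
  · simp [h0]
  · obtain ⟨i, hi⟩ := Function.ne_iff.mp h0
    exact Finset.prod_eq_zero (Finset.mem_univ i) (by simpa using hi)

theorem sum_correlation (hχ : χ.IsPrimitive) {ι : Type*} [Fintype ι] (w : ι → ℂ) (f : ι → F)
    (c : F) :
    ∑ u : F, (∑ i, w i * χ (c * u * f i)) * (∑ j, w j * χ (-u * f j)) =
      Fintype.card F * ∑ i, ∑ j, if c * f i = f j then w i * w j else 0 := by
  simp_rw [Finset.sum_mul_sum]
  rw [Finset.sum_comm, Finset.mul_sum]
  refine Finset.sum_congr rfl fun i _ => ?_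
  rw [Finset.sum_comm, Finset.mul_sum]
  refine Finset.sum_congr rfl fun j _ => ?_
  have h : ∀ u : F, w i * χ (c * u * f i) * (w j * χ (-u * f j)) =
      w i * w j * χ (u * (c * f i - f j)) := fun u => by
    rw [show u * (c * f i - f j) = c * u * f i + -u * f j by ring, AddChar.map_add_eq_mul]
    ring
  simp_rw [h]
  rw [← Finset.mul_sum, AddChar.sum_mulShift _ hχ]
  simp only [sub_eq_zero]
  split_ifs
  · ring
  · simp

theorem quadGaussSum_mul_neg (hχ : χ.IsPrimitive) (h2 : (2 : F) ≠ 0) {u : F} (hu : u ≠ 0) :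
    quadGaussSum d χ u * quadGaussSum d χ (-u) = (Fintype.card F : ℂ) ^ d := by
  unfold quadGaussSum
  rw [Finset.sum_mul_sum, Finset.sum_comm]
  have h : ∀ n : Fin d → F, ∑ m : Fin d → F, χ (u * nrm m) * χ (-u * nrm n) =
      ∑ k : Fin d → F, χ (u * nrm k) * χ (∑ i, n i * ((2 * u) • k) i) := fun n => by
    rw [← Equiv.sum_comp (Equiv.addRight n)]
    refine Finset.sum_congr rfl fun k _ => ?_
    rw [← AddChar.map_add_eq_mul, ← AddChar.map_add_eq_mul, Equiv.coe_addRight, nrm_add]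
    have : ∑ i, n i * ((2 * u) • k) i = 2 * u * ∑ i, k i * n i := by
      rw [Finset.mul_sum]
      exact Finset.sum_congr rfl fun i _ => by simp only [Pi.smul_apply, smul_eq_mul]; ring
    rw [this]
    ring_nf
  simp_rw [h]
  rw [Finset.sum_comm]
  simp_rw [← Finset.mul_sum, sum_addChar_dotProduct hχ]
  simp [h2, hu, nrm]

theorem sum_energyFT (hχ : χ.IsPrimitive) (E : Finset (Fin d → F)) :
    ∑ m, (energyFT χ E m : ℂ) = (Fintype.card F : ℂ) ^ d * E.card := by
  simp_rw [energyFT_eq]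
  rw [Finset.sum_comm]
  have h : ∀ x ∈ E, ∑ m : Fin d → F, ∑ y ∈ E, χ (∑ i, m i * (x - y) i) =
      (Fintype.card F : ℂ) ^ d := fun x hx => by
    rw [Finset.sum_comm]
    simp_rw [sum_addChar_dotProduct hχ, sub_eq_zero]
    simp [hx]
  rw [Finset.sum_congr rfl h]
  simp [mul_comm]

theorem sum_nu_mul_addChar (E : Finset (Fin d → F)) (s : F) :
    ∑ t, (nu E t : ℂ) * χ (s * t) = ∑ x ∈ E, ∑ y ∈ E, χ (s * nrm (x - y)) := by
  rw [← Finset.sum_product', ← Finset.sum_fiberwise (E ×ˢ E) fun p => nrm (p.1 - p.2)]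
  refine Finset.sum_congr rfl fun t _ => ?_
  rw [Finset.sum_congr rfl (g := fun _ => χ (s * t)) fun p hp => by
    rw [(Finset.mem_filter.mp hp).2]]
  simp [nu]

theorem sum_nu (E : Finset (Fin d → F)) : ∑ t, (nu E t : ℂ) = (E.card : ℂ) ^ 2 := by
  have h := sum_nu_mul_addChar (χ := 1) E 0
  simpa [sq] using h

theorem sum_nu_mul_addChar_mul_quadGaussSum (h2 : (2 : F) ≠ 0) (E : Finset (Fin d → F)) {s : F}
    (hs : s ≠ 0) :
    (∑ t, (nu E t : ℂ) * χ (s * t)) * quadGaussSum d χ (-(4 * s)⁻¹) =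
      ∑ m, (energyFT χ E m : ℂ) * χ (-(4 * s)⁻¹ * nrm m) := by
  rw [sum_nu_mul_addChar]
  simp_rw [energyFT_eq, Finset.sum_mul, addChar_mul_quadGaussSum h2 hs]
  rw [Finset.sum_comm (s := univ)]
  refine Finset.sum_congr rfl fun x _ => ?_
  rw [Finset.sum_comm (s := univ)]
  exact Finset.sum_congr rfl fun y _ => Finset.sum_congr rfl fun m _ => mul_comm _ _

/-- The spectral form of the correlation `∑ t, ν(t) ν(r t)` for a nonzero square ratio. -/
theorem sum_nu_mul_nu_eq (hχ : χ.IsPrimitive) (h2 : (2 : F) ≠ 0) (E : Finset (Fin d → F)) {a : F}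
    (ha : a ≠ 0) :
    (Fintype.card F : ℝ) ^ d *
        (Fintype.card F * (∑ t, (nu E t : ℝ) * nu E (a ^ 2 * t)) - (E.card : ℝ) ^ 4) =
      Fintype.card F * (∑ m, ∑ n, if (a ^ 2)⁻¹ * nrm m = nrm n
        then energyFT χ E m * energyFT χ E n else 0) -
      ((Fintype.card F : ℝ) ^ d * E.card) ^ 2 := by
  have h4 : (4 : F) ≠ 0 := by
    rw [show (4 : F) = 2 * 2 by norm_num]; exact mul_ne_zero h2 h2
  set A : F → ℂ := fun s => ∑ t, (nu E t : ℂ) * χ (s * t) with hA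
  set B : F → ℂ := fun u => ∑ m, (energyFT χ E m : ℂ) * χ (u * nrm m) with hB
  have hinv : Function.Involutive fun s : F => -(4 * s)⁻¹ := fun s => by
    by_cases hs : s = 0
    · simp [hs]
    · field_simp
  have hAB : ∀ s : F, s ≠ 0 → (Fintype.card F : ℂ) ^ d * (A (a ^ 2 * s) * A (-s)) =
      B ((a ^ 2)⁻¹ * (-(4 * s)⁻¹)) * B (-(-(4 * s)⁻¹)) := fun s hs => by
    have e1 := sum_nu_mul_addChar_mul_quadGaussSum (χ := χ) h2 E
      (mul_ne_zero (pow_ne_zero 2 ha) hs)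
    have e2 := sum_nu_mul_addChar_mul_quadGaussSum (χ := χ) h2 E (neg_ne_zero.mpr hs)
    rw [show -(4 * (a ^ 2 * s))⁻¹ = (a ^ 2)⁻¹ * (-(4 * s)⁻¹) by
      rw [mul_left_comm, mul_inv]; ring] at e1
    rw [show -(4 * -s)⁻¹ = -(-(4 * s)⁻¹) by rw [mul_neg, inv_neg]] at e2
    simp only [hA, hB]
    rw [← e1, ← e2, ← inv_pow, quadGaussSum_sq_mul (inv_ne_zero ha),
      ← quadGaussSum_mul_neg (d := d) hχ h2
        (neg_ne_zero.mpr (inv_ne_zero (mul_ne_zero h4 hs)))]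
    ring
  have hsum : (Fintype.card F : ℂ) ^ d * (∑ s, A (a ^ 2 * s) * A (-s) - A 0 * A 0) =
      ∑ u, B ((a ^ 2)⁻¹ * u) * B (-u) - B 0 * B 0 := by
    rw [← Equiv.sum_comp (hinv.toPerm _) fun u => B ((a ^ 2)⁻¹ * u) * B (-u)]
    have l := Finset.sum_erase_eq_sub (f := fun s => A (a ^ 2 * s) * A (-s)) (Finset.mem_univ 0)
    have m := Finset.sum_erase_eq_sub
      (f := fun s => B ((a ^ 2)⁻¹ * (hinv.toPerm _ s)) * B (-(hinv.toPerm _ s))) (Finset.mem_univ 0)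
    simp only [Function.Involutive.coe_toPerm, mul_zero, neg_zero, inv_zero] at l m ⊢
    rw [← l, ← m, Finset.mul_sum]
    exact Finset.sum_congr rfl fun s hs => hAB s (Finset.ne_of_mem_erase hs)
  have hA0 : A 0 = (E.card : ℂ) ^ 2 := by simp [hA, sum_nu]
  have hB0 : B 0 = (Fintype.card F : ℂ) ^ d * E.card := by simp [hB, sum_energyFT hχ]
  have hcA := sum_correlation hχ (fun t => (nu E t : ℂ)) id (a ^ 2)
  have hcB := sum_correlation hχ (fun m => (energyFT χ E m : ℂ)) nrm (a ^ 2)⁻¹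
  simp only [id_eq, Finset.sum_ite_eq, Finset.mem_univ, if_true] at hcA
  simp only [hA0, hB0] at hsum
  simp only [hA, hB] at hsum
  rw [hcA, hcB] at hsum
  have key : (((Fintype.card F : ℝ) ^ d *
        (Fintype.card F * (∑ t, (nu E t : ℝ) * nu E (a ^ 2 * t)) - (E.card : ℝ) ^ 4) : ℝ) : ℂ) =
      ((Fintype.card F * (∑ m, ∑ n, if (a ^ 2)⁻¹ * nrm m = nrm n
        then energyFT χ E m * energyFT χ E n else 0) -
      ((Fintype.card F : ℝ) ^ d * E.card) ^ 2 : ℝ) : ℂ) := by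
    push_cast [apply_ite Complex.ofReal]
    linear_combination hsum
  exact_mod_cast key

end CharacterSums

theorem nu_sum_lower_odd (F : Type) [Field F] [Fintype F] [DecidableEq F]
    (hq : Odd (Fintype.card F)) (d : ℕ) (hd : 3 ≤ d) (hdo : Odd d)
    (E : Finset (Fin d → F)) (r : F) (hr : r ≠ 0) (hsq : IsSquare r) :
    (Fintype.card F : ℝ)⁻¹ * (E.card : ℝ) ^ 4 - 2 * (E.card : ℝ) ^ 3
      - (Fintype.card F : ℝ) ^ (d - 1) * (E.card : ℝ) ^ 2
    ≤ ∑ t : F, (nu E t : ℝ) * (nu E (r * t) : ℝ) := by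
  obtain ⟨a, rfl⟩ := hsq
  have ha : a ≠ 0 := left_ne_zero_of_mul hr
  obtain ⟨χ, hχ⟩ : ∃ χ : AddChar F ℂ, χ.IsPrimitive :=
    ⟨_, AddChar.FiniteField.primitiveChar_to_Complex_isPrimitive F⟩
  have key := sum_nu_mul_nu_eq hχ (two_ne_zero_of_odd_card F hq) E ha
  have hM : 0 ≤ ∑ m, ∑ n, if (a ^ 2)⁻¹ * nrm m = nrm n
      then energyFT χ E m * energyFT χ E n else 0 :=
    Finset.sum_nonneg fun m _ => Finset.sum_nonneg fun n _ => by
      split_ifs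
      · exact mul_nonneg (Complex.normSq_nonneg _) (Complex.normSq_nonneg _)
      · exact le_rfl
  have hQ : (0 : ℝ) < Fintype.card F := Nat.cast_pos.mpr Fintype.card_pos
  rw [← sq]
  generalize (∑ m, ∑ n, if (a ^ 2)⁻¹ * nrm m = nrm n
      then energyFT χ E m * energyFT χ E n else 0) = M at key hM
  generalize (∑ t, (nu E t : ℝ) * nu E (a ^ 2 * t)) = N at key ⊢
  obtain ⟨k, rfl⟩ : ∃ k, d = k + 1 := ⟨d - 1, by omega⟩
  rw [Nat.add_sub_cancel]
  have hN : N = (Fintype.card F : ℝ)⁻¹ * (E.card : ℝ) ^ 4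
      - (Fintype.card F : ℝ) ^ k * (E.card : ℝ) ^ 2 + M / (Fintype.card F : ℝ) ^ (k + 1) := by
    field_simp
    linear_combination key
  have h3 : (0 : ℝ) ≤ 2 * (E.card : ℝ) ^ 3 := by positivity
  have h5 : 0 ≤ M / (Fintype.card F : ℝ) ^ (k + 1) := by positivity
  linarith
end

section
/- Let d ≥ 3 be odd and E ⊆ F_q^d. Then ν(0) ≤ q^{−1}·|E|² + q^{(d−1)/2}·|E|; consequently ν(0)² ≤ q^{−2}·|E|⁴ + 2·q^{(d−3)/2}·|E|³ + q^{d−1}·|E|². -/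
open Finset

namespace IsotropicDistance

lemma four_ne_zero_of_ringChar_ne_two {F : Type} [Field F] (hF : ringChar F ≠ 2) :
    (4 : F) ≠ 0 := by
  rw [show (4 : F) = 2 * 2 by norm_num]
  exact mul_ne_zero (Ring.two_ne_zero hF) (Ring.two_ne_zero hF)

lemma map_sum_eq_prod {F : Type} [Field F] {ι : Type*} (χ : AddChar F ℂ) (s : Finset ι)
    (f : ι → F) :
    χ (∑ i ∈ s, f i) = ∏ i ∈ s, χ (f i) := by
  classical
  induction s using Finset.induction_on with
  | empty => simp
  | insert i s hi ih => rw [sum_insert hi, prod_insert hi, AddChar.map_add_eq_mul, ih]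

lemma normSq_sum_char_dotProduct {F : Type} [Field F] [Fintype F] (χ : AddChar F ℂ) {d : ℕ}
    (E : Finset (Fin d → F)) (m : Fin d → F) :
    ((‖∑ x ∈ E, χ (dotProduct m x)‖ ^ 2 : ℝ) : ℂ)
      = ∑ x ∈ E, ∑ y ∈ E, χ (dotProduct m (x - y)) := by
  rw [Complex.ofReal_pow, ← Complex.mul_conj', map_sum, sum_mul_sum]
  refine sum_congr rfl fun x _ => sum_congr rfl fun y _ => ?_
  rw [← AddChar.map_neg_eq_conj, ← AddChar.map_add_eq_mul, dotProduct_sub, sub_eq_add_neg]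

variable {F : Type} [Field F] [Fintype F] [DecidableEq F]

/-- The quadratic character of `F` with values in `ℂ`. -/
noncomputable def complexQuadraticChar (F : Type) [Field F] [Fintype F] [DecidableEq F] :
    MulChar F ℂ :=
  (quadraticChar F).ringHomComp (Int.castRingHom ℂ)

lemma complexQuadraticChar_apply (a : F) :
    complexQuadraticChar F a = ((quadraticChar F a : ℤ) : ℂ) := rfl

lemma complexQuadraticChar_isQuadratic : (complexQuadraticChar F).IsQuadratic :=
  (quadraticChar_isQuadratic F).comp _

lemma complexQuadraticChar_ne_one (hF : ringChar F ≠ 2) : complexQuadraticChar F ≠ 1 :=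
  (MulChar.ringHomComp_ne_one_iff (Int.cast_injective (α := ℂ))).mpr (quadraticChar_ne_one hF)

lemma complexQuadraticChar_sq {a : F} (ha : a ≠ 0) : complexQuadraticChar F a ^ 2 = 1 := by
  rw [complexQuadraticChar_apply]
  exact_mod_cast quadraticChar_sq_one ha

lemma norm_complexQuadraticChar_le_one (a : F) : ‖complexQuadraticChar F a‖ ≤ 1 := by
  rcases complexQuadraticChar_isQuadratic a with h | h | h <;> simp [h]

lemma sum_complexQuadraticChar_mul (hF : ringChar F ≠ 2) (χ : AddChar F ℂ) (a : F) :
    ∑ t, complexQuadraticChar F t * χ (t * a)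
      = complexQuadraticChar F a * gaussSum (complexQuadraticChar F) χ := by
  by_cases ha : a = 0
  · simp [ha, MulChar.map_zero, MulChar.sum_eq_zero_of_ne_one (complexQuadraticChar_ne_one hF)]
  · have h := gaussSum_mulShift_eq (complexQuadraticChar F) χ (Units.mk0 a ha)
    rw [complexQuadraticChar_isQuadratic.inv] at h
    rw [← Units.val_mk0 ha, ← h]
    simp [gaussSum, mul_comm]

lemma sum_char_mul_sq (hF : ringChar F ≠ 2) {χ : AddChar F ℂ} (hχ : χ.IsPrimitive) {t : F}
    (ht : t ≠ 0) :
    ∑ u, χ (t * u ^ 2) = complexQuadraticChar F t * gaussSum (complexQuadraticChar F) χ := by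
  have hcard (a : F) :
      (((univ.filter fun u : F => u ^ 2 = a).card : ℕ) : ℂ) = complexQuadraticChar F a + 1 := by
    have h := quadraticChar_card_sqrts hF a
    rw [complexQuadraticChar_apply, ← Int.cast_one, ← Int.cast_add, ← h]
    simp [Set.toFinset_ofPred]
  have hsum : ∑ a, χ (a * t) = 0 := by
    rw [AddChar.sum_mulShift t hχ, if_neg ht, Nat.cast_zero]
  calc ∑ u, χ (t * u ^ 2)
      = ∑ a, ∑ u with u ^ 2 = a, χ (t * a) := (sum_fiberwise' univ (· ^ 2) fun a => χ (t * a)).symm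
    _ = ∑ a, (complexQuadraticChar F a * χ (a * t) + χ (a * t)) := by
        refine sum_congr rfl fun a _ => ?_
        rw [sum_const, nsmul_eq_mul, hcard, mul_comm t a]
        ring
    _ = _ := by rw [sum_add_distrib, hsum, add_zero, sum_complexQuadraticChar_mul hF]

lemma sum_char_quadratic (hF : ringChar F ≠ 2) {χ : AddChar F ℂ} (hχ : χ.IsPrimitive) {t : F}
    (ht : t ≠ 0) (z : F) :
    ∑ u, χ (t * u ^ 2 + u * z)
      = complexQuadraticChar F t * gaussSum (complexQuadraticChar F) χ
        * χ (-(4 * t)⁻¹ * z ^ 2) := by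
  have h2 : (2 : F) ≠ 0 := Ring.two_ne_zero hF
  have h4 := four_ne_zero_of_ringChar_ne_two hF
  rw [← sum_char_mul_sq hF hχ ht, sum_mul,
    ← Equiv.sum_comp (Equiv.addRight (z / (2 * t)))
      fun u => χ (t * u ^ 2) * χ (-(4 * t)⁻¹ * z ^ 2)]
  refine sum_congr rfl fun u _ => ?_
  rw [← AddChar.map_add_eq_mul]
  congr 1
  simp only [Equiv.coe_addRight]
  field_simp
  ring

lemma sum_char_nrm_add_dotProduct (hF : ringChar F ≠ 2) {χ : AddChar F ℂ} (hχ : χ.IsPrimitive)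
    {d : ℕ} {t : F} (ht : t ≠ 0) (z : Fin d → F) :
    ∑ m : Fin d → F, χ (t * nrm m + dotProduct m z)
      = (complexQuadraticChar F t * gaussSum (complexQuadraticChar F) χ) ^ d
        * χ (-(4 * t)⁻¹ * nrm z) := by
  have h (m : Fin d → F) :
      χ (t * nrm m + dotProduct m z) = ∏ i, χ (t * m i ^ 2 + m i * z i) := by
    rw [← map_sum_eq_prod, nrm, dotProduct, mul_sum, sum_add_distrib]
  simp_rw [h]
  rw [← Fintype.prod_sum fun i u => χ (t * u ^ 2 + u * z i)]
  simp_rw [sum_char_quadratic hF hχ ht]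
  rw [prod_mul_distrib, prod_const, card_univ, Fintype.card_fin, ← map_sum_eq_prod, nrm,
    mul_sum]

lemma sum_char_dotProduct {χ : AddChar F ℂ} (hχ : χ.IsPrimitive) {d : ℕ} (z : Fin d → F) :
    ∑ m : Fin d → F, χ (dotProduct m z) = if z = 0 then (Fintype.card F : ℂ) ^ d else 0 := by
  have h (m : Fin d → F) : χ (dotProduct m z) = ∏ i, χ (m i * z i) := by
    rw [← map_sum_eq_prod, dotProduct]
  simp_rw [h]
  rw [← Fintype.prod_sum fun i u => χ (u * z i)]
  simp_rw [AddChar.sum_mulShift _ hχ]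
  split_ifs with hz
  · simp [hz]
  · obtain ⟨i, hi⟩ := Function.ne_iff.mp hz
    exact prod_eq_zero (mem_univ i) (by simpa using hi)

lemma sum_nonzero_char_inv (hF : ringChar F ≠ 2) {χ : AddChar F ℂ} (hχ : χ.IsPrimitive) (a : F) :
    ∑ t with t ≠ 0, χ (-(4 * t)⁻¹ * a) = (if a = 0 then (Fintype.card F : ℂ) else 0) - 1 := by
  have h4 := four_ne_zero_of_ringChar_ne_two hF
  have hinv : ∑ t with t ≠ 0, χ (-(4 * t)⁻¹ * a) = ∑ t with t ≠ 0, χ (t * a) := by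
    refine sum_bij' (fun t _ => -(4 * t)⁻¹) (fun t _ => -(4 * t)⁻¹) ?_ ?_ ?_ ?_ ?_
    · simp [h4]
    · simp [h4]
    · intro t ht
      simp only [mem_filter, mem_univ, true_and] at ht
      field_simp
    · intro t ht
      simp only [mem_filter, mem_univ, true_and] at ht
      field_simp
    · simp
  have hall := AddChar.sum_mulShift a hχ
  rw [← sum_filter_add_sum_filter_not univ (fun t : F => t ≠ 0)] at hall
  rw [hinv, eq_sub_iff_add_eq]
  simpa [filter_eq'] using hall

lemma sum_complexQuadraticChar_nrm_mul_char (hF : ringChar F ≠ 2) {χ : AddChar F ℂ}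
    (hχ : χ.IsPrimitive) {k : ℕ} (z : Fin (2 * k + 1) → F) :
    ∑ m : Fin (2 * k + 1) → F, complexQuadraticChar F (nrm m) * χ (dotProduct m z)
      = gaussSum (complexQuadraticChar F) χ ^ (2 * k)
        * ((if nrm z = 0 then (Fintype.card F : ℂ) else 0) - 1) := by
  set g := gaussSum (complexQuadraticChar F) χ
  have hg0 : g ≠ 0 := gaussSum_ne_zero_of_nontrivial (by simp) (complexQuadraticChar_ne_one hF) hχ
  apply mul_right_cancel₀ hg0
  calc (∑ m : Fin (2 * k + 1) → F, complexQuadraticChar F (nrm m) * χ (dotProduct m z)) * g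
      = ∑ m : Fin (2 * k + 1) → F, ∑ t, complexQuadraticChar F t *
          χ (t * nrm m + dotProduct m z) := by
        rw [sum_mul]
        refine sum_congr rfl fun m _ => ?_
        rw [mul_right_comm, ← sum_complexQuadraticChar_mul hF, sum_mul]
        simp_rw [AddChar.map_add_eq_mul, mul_assoc]
    _ = ∑ t, complexQuadraticChar F t *
          ∑ m : Fin (2 * k + 1) → F, χ (t * nrm m + dotProduct m z) := by
        rw [sum_comm]
        simp_rw [mul_sum]
    _ = ∑ t with t ≠ 0, g ^ (2 * k + 1) * χ (-(4 * t)⁻¹ * nrm z) := by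
        rw [sum_filter]
        refine sum_congr rfl fun t _ => ?_
        split_ifs with ht
        · rw [sum_char_nrm_add_dotProduct hF hχ ht, mul_pow, pow_succ (complexQuadraticChar F t),
            pow_mul, complexQuadraticChar_sq ht, one_pow, one_mul, ← mul_assoc, ← mul_assoc,
            ← sq, complexQuadraticChar_sq ht, one_mul]
        · rw [not_not.mp ht, MulChar.map_zero, zero_mul]
    _ = _ := by
        rw [← mul_sum, sum_nonzero_char_inv hF hχ]
        ring

lemma sum_normSq_sum_char_dotProduct {χ : AddChar F ℂ} (hχ : χ.IsPrimitive) {d : ℕ}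
    (E : Finset (Fin d → F)) :
    ∑ m : Fin d → F, ‖∑ x ∈ E, χ (dotProduct m x)‖ ^ 2 = (Fintype.card F : ℝ) ^ d * E.card := by
  apply Complex.ofReal_injective
  rw [Complex.ofReal_sum]
  simp_rw [normSq_sum_char_dotProduct]
  rw [sum_comm]
  simp_rw [sum_comm (s := univ), sum_char_dotProduct hχ, sub_eq_zero]
  simp [mul_comm]

lemma norm_gaussSum_complexQuadraticChar_sq (hF : ringChar F ≠ 2) {χ : AddChar F ℂ}
    (hχ : χ.IsPrimitive) :
    ‖gaussSum (complexQuadraticChar F) χ‖ ^ 2 = Fintype.card F := by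
  apply Complex.ofReal_injective
  rw [Complex.ofReal_pow, ← Complex.mul_conj', starRingEnd_apply, star_gaussSum_eq,
    gaussSum_mul_gaussSum_eq_card (complexQuadraticChar_ne_one hF) hχ]
  simp

/-- In odd dimension `2k + 1`, the number of pairs of `E` at distance zero deviates from
`|E|² / q` by at most `q ^ k |E|`. -/
lemma abs_card_mul_nu_zero_sub_le (hF : ringChar F ≠ 2) {k : ℕ}
    (E : Finset (Fin (2 * k + 1) → F)) :
    |(Fintype.card F : ℝ) * nu E 0 - (E.card : ℝ) ^ 2|
      ≤ (Fintype.card F : ℝ) ^ (k + 1) * E.card := by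
  obtain ⟨χ, hχ⟩ : ∃ χ : AddChar F ℂ, χ.IsPrimitive :=
    ⟨_, AddChar.FiniteField.primitiveChar_to_Complex_isPrimitive F⟩
  have hq : (0 : ℝ) < Fintype.card F := by exact_mod_cast Fintype.card_pos
  have hnu : ∑ x ∈ E, ∑ y ∈ E, ((if nrm (x - y) = 0 then (Fintype.card F : ℂ) else 0) - 1)
      = (((Fintype.card F : ℝ) * nu E 0 - (E.card : ℝ) ^ 2 : ℝ) : ℂ) := by
    rw [← sum_product', sum_sub_distrib, ← sum_filter]
    simp [nu, card_product, sq, mul_comm]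
  have hkey : ∑ m : Fin (2 * k + 1) → F, complexQuadraticChar F (nrm m)
        * ((‖∑ x ∈ E, χ (dotProduct m x)‖ ^ 2 : ℝ) : ℂ)
      = gaussSum (complexQuadraticChar F) χ ^ (2 * k)
        * (((Fintype.card F : ℝ) * nu E 0 - (E.card : ℝ) ^ 2 : ℝ) : ℂ) := by
    simp_rw [normSq_sum_char_dotProduct, ← hnu, mul_sum]
    rw [sum_comm]
    refine sum_congr rfl fun x _ => ?_
    rw [sum_comm]
    exact sum_congr rfl fun y _ => sum_complexQuadraticChar_nrm_mul_char hF hχ (x - y)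
  have hbound : (Fintype.card F : ℝ) ^ k * |(Fintype.card F : ℝ) * nu E 0 - (E.card : ℝ) ^ 2|
      ≤ (Fintype.card F : ℝ) ^ (2 * k + 1) * E.card := by
    rw [← sum_normSq_sum_char_dotProduct hχ E]
    calc _ = ‖gaussSum (complexQuadraticChar F) χ ^ (2 * k)
          * (((Fintype.card F : ℝ) * nu E 0 - (E.card : ℝ) ^ 2 : ℝ) : ℂ)‖ := by
          rw [norm_mul, norm_pow, pow_mul, norm_gaussSum_complexQuadraticChar_sq hF hχ,
            Complex.norm_real, Real.norm_eq_abs]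
      _ ≤ _ := by
          rw [← hkey]
          refine norm_sum_le_of_le _ fun m _ => ?_
          rw [norm_mul, Complex.norm_real, Real.norm_of_nonneg (by positivity)]
          exact mul_le_of_le_one_left (by positivity) (norm_complexQuadraticChar_le_one _)
  refine le_of_mul_le_mul_left (hbound.trans_eq ?_) (pow_pos hq k)
  ring

end IsotropicDistance

theorem nu_zero_upper_odd (F : Type) [Field F] [Fintype F] [DecidableEq F]
    (hq : Odd (Fintype.card F)) (d : ℕ) (hd : 3 ≤ d) (hdo : Odd d)
    (E : Finset (Fin d → F)) :
    (nu E 0 : ℝ) ≤ (Fintype.card F : ℝ)⁻¹ * (E.card : ℝ) ^ 2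
        + (Fintype.card F : ℝ) ^ ((d - 1) / 2) * (E.card : ℝ) ∧
    (nu E 0 : ℝ) ^ 2 ≤ ((Fintype.card F : ℝ)⁻¹) ^ 2 * (E.card : ℝ) ^ 4
        + 2 * (Fintype.card F : ℝ) ^ ((d - 3) / 2) * (E.card : ℝ) ^ 3
        + (Fintype.card F : ℝ) ^ (d - 1) * (E.card : ℝ) ^ 2 := by
  have hF : ringChar F ≠ 2 := fun h => by
    have := FiniteField.even_card_of_char_two h
    rw [Nat.odd_iff] at hq
    omega
  obtain ⟨k, rfl⟩ := hdo
  obtain ⟨j, rfl⟩ : ∃ j, k = j + 1 := ⟨k - 1, by omega⟩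
  have hpos : (0 : ℝ) < Fintype.card F := by exact_mod_cast Fintype.card_pos
  have h := (abs_le.mp (IsotropicDistance.abs_card_mul_nu_zero_sub_le hF E)).2
  rw [show (2 * (j + 1) + 1 - 1) / 2 = j + 1 by omega,
    show (2 * (j + 1) + 1 - 3) / 2 = j by omega, show 2 * (j + 1) + 1 - 1 = 2 * (j + 1) by omega]
  have hfirst : (nu E 0 : ℝ) ≤ (Fintype.card F : ℝ)⁻¹ * (E.card : ℝ) ^ 2
      + (Fintype.card F : ℝ) ^ (j + 1) * (E.card : ℝ) := by
    refine le_of_mul_le_mul_left ?_ hpos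
    rw [mul_add (Fintype.card F : ℝ), mul_inv_cancel_left₀ hpos.ne',
      ← mul_assoc (Fintype.card F : ℝ), ← pow_succ' (Fintype.card F : ℝ)]
    linarith
  refine ⟨hfirst, (pow_le_pow_left₀ (Nat.cast_nonneg _) hfirst 2).trans_eq ?_⟩
  field_simp
  ring
end
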